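/- Let P̂ be a second transition dynamics on the same state and action spaces, and let π_n and η be any two policies such that E_{s∼d_{π_n}}[D_TV(η(·|s), π_n(·|s))] ≤ α for some α ≥ 0. Then E_{(s,a)∼d_η η}[‖P̂_{s,a} − P_{s,a}‖₁] ≤ E_{(s,a)∼d_{π_n} π_n}[‖P̂_{s,a} − P_{s,a}‖₁] + 8α/(1−γ). -/

import Mathlib

open scoped BigOperators

noncomputable section

/-- `p` is a probability distribution on a finite type. -/
def IsDist {X : Type*} [Fintype X] (p : X → ℝ) : Prop :=
  (∀ x, 0 ≤ p x) ∧ ∑ x, p x = 1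

/-- `P` is a transition dynamics: `P s a` is a distribution over next states. -/
def IsDynamics {S A : Type*} [Fintype S] (P : S → A → S → ℝ) : Prop :=
  ∀ s a, IsDist (P s a)

/-- `π` is a (stochastic) policy: `π s` is a distribution over actions. -/
def IsPolicy {S A : Type*} [Fintype A] (π : S → A → ℝ) : Prop :=
  ∀ s, IsDist (π s)

/-- One-step evolution of a state distribution under policy `π` and dynamics `P`. -/
def step {S A : Type*} [Fintype S] [Fintype A]
    (P : S → A → S → ℝ) (π : S → A → ℝ) (d : S → ℝ) : S → ℝ :=
  fun s' => ∑ s, ∑ a, d s * π s a * P s a s'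

/-- The time-`t` state distribution `d_π^t` starting from `ρ₀`. -/
def stateDist {S A : Type*} [Fintype S] [Fintype A]
    (P : S → A → S → ℝ) (π : S → A → ℝ) (ρ₀ : S → ℝ) : ℕ → S → ℝ
  | 0 => ρ₀
  | t + 1 => step P π (stateDist P π ρ₀ t)

/-- Discounted state visitation distribution `d_π = (1-γ) Σ_t γ^t d_π^t`. -/
def visit {S A : Type*} [Fintype S] [Fintype A]
    (γ : ℝ) (P : S → A → S → ℝ) (π : S → A → ℝ) (ρ₀ : S → ℝ) : S → ℝ :=
  fun s => (1 - γ) * ∑' t : ℕ, γ ^ t * stateDist P π ρ₀ t s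

/-- Expected cost of one step when the state is distributed as `d` and actions follow `π`. -/
def expCost {S A : Type*} [Fintype S] [Fintype A]
    (c : S → A → ℝ) (π : S → A → ℝ) (d : S → ℝ) : ℝ :=
  ∑ s, ∑ a, d s * π s a * c s a

/-- Value function `V^π(s₀)`: expected total discounted cost starting at `s₀`. -/
def Vf {S A : Type*} [Fintype S] [Fintype A] [DecidableEq S]
    (γ : ℝ) (P : S → A → S → ℝ) (c : S → A → ℝ) (π : S → A → ℝ) (s₀ : S) : ℝ :=
  ∑' t : ℕ, γ ^ t * expCost c π (stateDist P π (fun s => if s = s₀ then 1 else 0) t)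

/-- Objective `J(π) = E_{s∼ρ₀}[V^π(s)]`. -/
def Jf {S A : Type*} [Fintype S] [Fintype A] [DecidableEq S]
    (γ : ℝ) (P : S → A → S → ℝ) (c : S → A → ℝ) (ρ₀ : S → ℝ) (π : S → A → ℝ) : ℝ :=
  ∑ s, ρ₀ s * Vf γ P c π s

/-- State-action value `Q^π(s,a) = c(s,a) + γ E_{s'∼P_{s,a}}[V^π(s')]`. -/
def Qf {S A : Type*} [Fintype S] [Fintype A] [DecidableEq S]
    (γ : ℝ) (P : S → A → S → ℝ) (c : S → A → ℝ) (π : S → A → ℝ) (s : S) (a : A) : ℝ :=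
  c s a + γ * ∑ s', P s a s' * Vf γ P c π s'

/-- Disadvantage function `A^π(s,a) = Q^π(s,a) - V^π(s)`. -/
def Adv {S A : Type*} [Fintype S] [Fintype A] [DecidableEq S]
    (γ : ℝ) (P : S → A → S → ℝ) (c : S → A → ℝ) (π : S → A → ℝ) (s : S) (a : A) : ℝ :=
  Qf γ P c π s a - Vf γ P c π s

section Occupancy

variable {S A : Type*} [Fintype S] [Fintype A]

theorem IsDist.le_one {X : Type*} [Fintype X] {p : X → ℝ} (hp : IsDist p) (x : X) : p x ≤ 1 :=
  hp.2 ▸ Finset.single_le_sum (fun y _ => hp.1 y) (Finset.mem_univ x)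

/-- The `ℓ¹` distance between two distributions is at most `2`. -/
theorem IsDist.sum_abs_sub_le_two {X : Type*} [Fintype X] {p q : X → ℝ}
    (hp : IsDist p) (hq : IsDist q) : ∑ x, |p x - q x| ≤ 2 :=
  calc ∑ x, |p x - q x| ≤ ∑ x, (p x + q x) := by
        refine Finset.sum_le_sum fun x _ => abs_le.2 ⟨?_, ?_⟩ <;> linarith [hp.1 x, hq.1 x]
    _ = 2 := by rw [Finset.sum_add_distrib, hp.2, hq.2]; norm_num

theorem IsDist.step {P : S → A → S → ℝ} {π : S → A → ℝ} {d : S → ℝ}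
    (hd : IsDist d) (hP : IsDynamics P) (hπ : IsPolicy π) : IsDist (step P π d) := by
  refine ⟨fun s' => Finset.sum_nonneg fun s _ => Finset.sum_nonneg fun a _ =>
    mul_nonneg (mul_nonneg (hd.1 s) ((hπ s).1 a)) ((hP s a).1 s'), ?_⟩
  unfold _root_.step
  rw [Finset.sum_comm]
  simp_rw [Finset.sum_comm (s := (Finset.univ : Finset S)) (t := (Finset.univ : Finset A)),
    ← Finset.mul_sum, (hP _ _).2, mul_one]
  rw [Finset.sum_comm]
  simp_rw [← Finset.mul_sum, (hπ _).2, mul_one]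
  exact hd.2

theorem IsDist.stateDist {P : S → A → S → ℝ} {π : S → A → ℝ} {ρ₀ : S → ℝ}
    (hρ : IsDist ρ₀) (hP : IsDynamics P) (hπ : IsPolicy π) (t : ℕ) :
    IsDist (stateDist P π ρ₀ t) := by
  induction t with
  | zero => exact hρ
  | succ t ih => exact ih.step hP hπ

theorem summable_discounted_stateDist {γ : ℝ} {P : S → A → S → ℝ} {π : S → A → ℝ} {ρ₀ : S → ℝ}
    (hγ : 0 ≤ γ) (hγ' : γ < 1) (hP : IsDynamics P) (hρ : IsDist ρ₀) (hπ : IsPolicy π) (s : S) :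
    Summable fun t : ℕ => γ ^ t * stateDist P π ρ₀ t s :=
  Summable.of_nonneg_of_le
    (fun t => mul_nonneg (pow_nonneg hγ t) ((hρ.stateDist hP hπ t).1 s))
    (fun t => mul_le_of_le_one_right (pow_nonneg hγ t) ((hρ.stateDist hP hπ t).le_one s))
    (summable_geometric_of_lt_one hγ hγ')

theorem visit_nonneg {γ : ℝ} {P : S → A → S → ℝ} {π : S → A → ℝ} {ρ₀ : S → ℝ}
    (hγ : 0 ≤ γ) (hγ' : γ < 1) (hP : IsDynamics P) (hρ : IsDist ρ₀) (hπ : IsPolicy π) (s : S) :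
    0 ≤ visit γ P π ρ₀ s :=
  mul_nonneg (sub_nonneg.2 hγ'.le)
    (tsum_nonneg fun t => mul_nonneg (pow_nonneg hγ t) ((hρ.stateDist hP hπ t).1 s))

/-- The flow (Bellman) equation for the discounted visitation distribution. -/
theorem visit_eq {γ : ℝ} {P : S → A → S → ℝ} {π : S → A → ℝ} {ρ₀ : S → ℝ}
    (hγ : 0 ≤ γ) (hγ' : γ < 1) (hP : IsDynamics P) (hρ : IsDist ρ₀) (hπ : IsPolicy π) (s' : S) :
    visit γ P π ρ₀ s' = (1 - γ) * ρ₀ s' + γ * step P π (visit γ P π ρ₀) s' := by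
  have hs := summable_discounted_stateDist hγ hγ' hP hρ hπ
  have hsum : HasSum (fun t : ℕ => γ ^ (t + 1) * stateDist P π ρ₀ (t + 1) s')
      (∑ s, ∑ a, γ * ((∑' t : ℕ, γ ^ t * stateDist P π ρ₀ t s) * π s a * P s a s')) := by
    have h := hasSum_sum (s := Finset.univ) fun s _ => hasSum_sum (s := Finset.univ) fun a _ =>
      ((((hs s).hasSum.mul_right (π s a)).mul_right (P s a s')).mul_left γ)
    refine h.congr_fun ?_
    intro t
    simp only [stateDist, step, Finset.mul_sum]
    refine Finset.sum_congr rfl fun s _ => Finset.sum_congr rfl fun a _ => ?_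
    ring
  have h0 : visit γ P π ρ₀ s' = (1 - γ) * (ρ₀ s' +
      ∑ s, ∑ a, γ * ((∑' t : ℕ, γ ^ t * stateDist P π ρ₀ t s) * π s a * P s a s')) := by
    rw [visit, (hs s').tsum_eq_zero_add, hsum.tsum_eq]
    simp [stateDist]
  rw [h0, mul_add]
  simp only [step, visit, Finset.mul_sum]
  congr 1
  refine Finset.sum_congr rfl fun s _ => Finset.sum_congr rfl fun a _ => ?_
  ring

/-- Pushing forward by the dynamics does not increase the `ℓ¹` distance of joint measures. -/
theorem sum_abs_step_sub_step_le {P : S → A → S → ℝ} (hP : IsDynamics P)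
    (π η : S → A → ℝ) (d e : S → ℝ) :
    ∑ s', |step P η d s' - step P π e s'| ≤ ∑ s, ∑ a, |d s * η s a - e s * π s a| :=
  calc ∑ s', |step P η d s' - step P π e s'|
      ≤ ∑ s', ∑ s, ∑ a, |d s * η s a - e s * π s a| * P s a s' := by
        refine Finset.sum_le_sum fun s' _ => ?_
        simp only [step, ← Finset.sum_sub_distrib, ← sub_mul]
        refine (Finset.abs_sum_le_sum_abs _ _).trans (Finset.sum_le_sum fun s _ => ?_)
        refine (Finset.abs_sum_le_sum_abs _ _).trans (Finset.sum_le_sum fun a _ => ?_)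
        rw [abs_mul, abs_of_nonneg ((hP s a).1 s')]
    _ = ∑ s, ∑ a, |d s * η s a - e s * π s a| := by
        rw [Finset.sum_comm]
        refine Finset.sum_congr rfl fun s _ => ?_
        rw [Finset.sum_comm]
        exact Finset.sum_congr rfl fun a _ => by rw [← Finset.mul_sum, (hP s a).2, mul_one]

theorem sum_abs_joint_sub_le {π η : S → A → ℝ} (hη : IsPolicy η) (d : S → ℝ) {e : S → ℝ}
    (he : ∀ s, 0 ≤ e s) :
    ∑ s, ∑ a, |d s * η s a - e s * π s a| ≤
      ∑ s, |d s - e s| + ∑ s, e s * ∑ a, |η s a - π s a| := by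
  rw [← Finset.sum_add_distrib]
  refine Finset.sum_le_sum fun s _ => ?_
  calc ∑ a, |d s * η s a - e s * π s a|
      ≤ ∑ a, (|d s - e s| * η s a + e s * |η s a - π s a|) := by
        refine Finset.sum_le_sum fun a _ => ?_
        have h : d s * η s a - e s * π s a =
            (d s - e s) * η s a + e s * (η s a - π s a) := by ring
        rw [h]
        refine (abs_add_le _ _).trans_eq ?_
        rw [abs_mul, abs_mul, abs_of_nonneg ((hη s).1 a), abs_of_nonneg (he s)]
    _ = |d s - e s| + e s * ∑ a, |η s a - π s a| := by
        rw [Finset.sum_add_distrib, ← Finset.mul_sum, ← Finset.mul_sum, (hη s).2, mul_one]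

/-- The discounted state-action occupancies of two policies are close in `ℓ¹` if the policies are
close on average over the states visited by one of them. -/
theorem sum_abs_occupancy_sub_le {γ : ℝ} {P : S → A → S → ℝ} {π η : S → A → ℝ} {ρ₀ : S → ℝ}
    (hγ : 0 ≤ γ) (hγ' : γ < 1) (hP : IsDynamics P) (hρ : IsDist ρ₀)
    (hπ : IsPolicy π) (hη : IsPolicy η) :
    ∑ s, ∑ a, |visit γ P η ρ₀ s * η s a - visit γ P π ρ₀ s * π s a| ≤
      (∑ s, visit γ P π ρ₀ s * ∑ a, |η s a - π s a|) / (1 - γ) := by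
  have hjoint := sum_abs_joint_sub_le (π := π) hη (visit γ P η ρ₀)
    (visit_nonneg hγ hγ' hP hρ hπ)
  have hstate : ∑ s, |visit γ P η ρ₀ s - visit γ P π ρ₀ s| ≤
      γ * ∑ s, ∑ a, |visit γ P η ρ₀ s * η s a - visit γ P π ρ₀ s * π s a| := by
    refine le_trans (le_of_eq ?_) (mul_le_mul_of_nonneg_left
      (sum_abs_step_sub_step_le hP π η (visit γ P η ρ₀) (visit γ P π ρ₀)) hγ)
    rw [Finset.mul_sum]
    refine Finset.sum_congr rfl fun s _ => ?_
    rw [visit_eq hγ hγ' hP hρ hη s, visit_eq hγ hγ' hP hρ hπ s, add_sub_add_left_eq_sub,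
      ← mul_sub, abs_mul, abs_of_nonneg hγ]
  rw [le_div_iff₀ (sub_pos.2 hγ')]
  linarith

end Occupancy

/-- If `E_{s∼d_{π_n}}[D_TV(η(·|s), π_n(·|s))] ≤ α`, then the expected model error under the
state-action distribution of `η` exceeds that under `π_n` by at most `8α/(1-γ)`. -/
theorem model_error_transfer
    {S A : Type*} [Fintype S] [Fintype A]
    (γ : ℝ) (P Phat : S → A → S → ℝ) (ρ₀ : S → ℝ)
    (hγ : 0 < γ) (hγ' : γ < 1) (hP : IsDynamics P) (hPhat : IsDynamics Phat) (hρ : IsDist ρ₀)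
    (πn η : S → A → ℝ) (hπn : IsPolicy πn) (hη : IsPolicy η)
    (α : ℝ) (hα : 0 ≤ α)
    (htv : ∑ s, visit γ P πn ρ₀ s * ((∑ a, |η s a - πn s a|) / 2) ≤ α) :
    ∑ s, ∑ a, visit γ P η ρ₀ s * η s a * (∑ s', |Phat s a s' - P s a s'|) ≤
      (∑ s, ∑ a, visit γ P πn ρ₀ s * πn s a * (∑ s', |Phat s a s' - P s a s'|)) +
        8 * α / (1 - γ) := by
  set J := ∑ s, ∑ a, |visit γ P η ρ₀ s * η s a - visit γ P πn ρ₀ s * πn s a| with hJ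
  have hJle : J ≤ 2 * α / (1 - γ) := by
    refine (sum_abs_occupancy_sub_le hγ.le hγ' hP hρ hπn hη).trans ?_
    refine div_le_div_of_nonneg_right ?_ (sub_nonneg.2 hγ'.le)
    simp only [← mul_div_assoc, ← Finset.sum_div] at htv
    linarith
  have hdiff : ∑ s, ∑ a, visit γ P η ρ₀ s * η s a * (∑ s', |Phat s a s' - P s a s'|) ≤
      (∑ s, ∑ a, visit γ P πn ρ₀ s * πn s a * (∑ s', |Phat s a s' - P s a s'|)) + J * 2 := by
    simp only [hJ, Finset.sum_mul, ← Finset.sum_add_distrib]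
    refine Finset.sum_le_sum fun s _ => Finset.sum_le_sum fun a _ => ?_
    rw [← sub_le_iff_le_add', ← sub_mul]
    exact mul_le_mul (le_abs_self _) ((hPhat s a).sum_abs_sub_le_two (hP s a))
      (Finset.sum_nonneg fun _ _ => abs_nonneg _) (abs_nonneg _)
  have hnonneg : 0 ≤ α / (1 - γ) := div_nonneg hα (sub_nonneg.2 hγ'.le)
  rw [mul_div_assoc] at hJle ⊢
  linarith
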